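/- arXiv:math/9308215 — 2 statements merged into one kernel-verified Lean document; each statement's English description precedes it below -/
import Mathlib

section
/- If a graph G on a vertex set X of cardinality less than 𝔟 is dominating, then G contains a uniform subdivision of T_ω. -/
open Filter Cardinal

/-- `f` is eventually dominated by `g`: `f n ≤ g n` for all but finitely many `n`. -/
def EvDom (f g : ℕ → ℕ) : Prop := ∀ᶠ n in Filter.atTop, f n ≤ g n

/-- A ray in `G`: an injective one-way infinite path. -/
def IsRay {X : Type} (G : SimpleGraph X) (R : ℕ → X) : Prop :=
  Function.Injective R ∧ ∀ n, G.Adj (R n) (R (n + 1))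

/-- A graph is dominating if some labelling makes the labels along rays a dominating family. -/
def DominatingGraph {X : Type} (G : SimpleGraph X) : Prop :=
  ∃ L : X → ℕ, ∀ f : ℕ → ℕ, ∃ R : ℕ → X, IsRay G R ∧ EvDom f (L ∘ R)

/-- `F` is a dominating family of functions. -/
def DomFamily (F : Set (ℕ → ℕ)) : Prop := ∀ g : ℕ → ℕ, ∃ f ∈ F, EvDom g f

/-- `F` is a bounded family of functions. -/
def BddFamily (F : Set (ℕ → ℕ)) : Prop := ∃ g : ℕ → ℕ, ∀ f ∈ F, EvDom f g

/-- The dominating number 𝔡. -/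
noncomputable def dNum : Cardinal := sInf {c | ∃ F : Set (ℕ → ℕ), DomFamily F ∧ #F = c}

/-- The bounding number 𝔟. -/
noncomputable def bNum : Cardinal := sInf {c | ∃ F : Set (ℕ → ℕ), ¬ BddFamily F ∧ #F = c}

/-- A branch vertex: one of countably infinite degree. -/
def BranchVtx {X : Type} (T : SimpleGraph X) (v : X) : Prop := #(T.neighborSet v) = ℵ₀

/-- `T` is a copy of `T_ω`: a tree all of whose vertices have countably infinite degree. -/
def IsTOmega {X : Type} (T : SimpleGraph X) : Prop :=
  T.IsTree ∧ ∀ v, BranchVtx T v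

/-- `T` is a subdivision of `T_ω`: a tree with all degrees 2 or ℵ₀ in which every ray
meets a branch vertex. -/
def IsSubdivTOmega {X : Type} (T : SimpleGraph X) : Prop :=
  T.IsTree ∧ (∀ v, #(T.neighborSet v) = 2 ∨ BranchVtx T v) ∧
    ∀ R : ℕ → X, IsRay T R → ∃ n, BranchVtx T (R n)

/-- `W` is a subdivided edge of `T` (from a branch vertex to a branch vertex, with
no branch vertices in its interior). -/
def SubdividedEdge {X : Type} (T : SimpleGraph X) {x y : X} (W : T.Walk x y) : Prop :=
  W.IsPath ∧ BranchVtx T x ∧ BranchVtx T y ∧ 0 < W.length ∧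
    ∀ v ∈ W.support, v ≠ x → v ≠ y → ¬ BranchVtx T v

/-- `T` is a uniform subdivision of `T_ω`: it has a root `r` such that at every branch
vertex `x`, all subdivided edges at `x` not towards `r` have the same length. -/
def UniformSubdivTOmega {X : Type} (T : SimpleGraph X) : Prop :=
  IsSubdivTOmega T ∧ ∃ r : X, BranchVtx T r ∧
    ∀ (x y z : X) (W : T.Walk x y) (W' : T.Walk x z),
      SubdividedEdge T W → SubdividedEdge T W' →
      (∀ P : T.Walk x r, P.IsPath → y ∉ P.support) →
      (∀ P : T.Walk x r, P.IsPath → z ∉ P.support) →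
      W.length = W'.length

/-- `Ps` is a family of disjoint paths starting at `x`: each member is a path from `x`,
and distinct members share no vertex other than `x`. -/
def DisjPathFam {X : Type} (G : SimpleGraph X) (x : X)
    (Ps : Set (Σ y : X, G.Walk x y)) : Prop :=
  (∀ P ∈ Ps, Sigma.snd P |>.IsPath) ∧
    ∀ P ∈ Ps, ∀ Q ∈ Ps, P ≠ Q →
      ∀ v, v ∈ (Sigma.snd P).support → v ∈ (Sigma.snd Q).support → v = x

/-- `p 0, …, p n` is a path of length `n` in `G`. -/
def IsPathSeq {X : Type} (G : SimpleGraph X) (n : ℕ) (p : ℕ → X) : Prop :=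
  Set.InjOn p (Set.Iic n) ∧ ∀ k < n, G.Adj (p k) (p (k + 1))

/-- No finite set avoiding `x` meets all paths of length `n` from `x` to `Z`. -/
def FanTo {X : Type} (G : SimpleGraph X) (n : ℕ) (x : X) (Z : Set X) : Prop :=
  ∀ S : Finset X, x ∉ S → ∃ p, IsPathSeq G n p ∧ p 0 = x ∧ p n ∈ Z ∧ ∀ k ≤ n, p k ∉ S

/-- Every vertex of `Z` sends infinitely many disjoint paths of some common positive length
to `Z`. -/
def FanClosed {X : Type} (G : SimpleGraph X) (Z : Set X) : Prop :=
  ∀ x ∈ Z, ∃ n, 0 < n ∧ FanTo G n x Z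

lemma FanTo.mono {X : Type} {G : SimpleGraph X} {n : ℕ} {x : X} {Z Z' : Set X} (h : Z ⊆ Z')
    (hZ : FanTo G n x Z) : FanTo G n x Z' := by
  intro S hS
  obtain ⟨p, hp, h0, hn, hk⟩ := hZ S hS
  exact ⟨p, hp, h0, h hn, hk⟩

/-- The vertices deleted at stage `α` of the transfinite process which removes every `x` that is
not `Good` for the set of vertices surviving all earlier stages. -/
noncomputable def deletedAt {X : Type} (Good : X → Set X → Prop) : Ordinal.{0} → Set X
  | α => {x | ¬ Good x {y | ∀ β, ∀ _ : β < α, y ∉ deletedAt Good β}}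
termination_by α => α

lemma mem_deletedAt {X : Type} {Good : X → Set X → Prop} {α : Ordinal.{0}} {x : X} :
    x ∈ deletedAt Good α ↔ ¬ Good x {y | ∀ β < α, y ∉ deletedAt Good β} := by
  rw [deletedAt]; rfl

lemma exists_rank {X : Type} {Good : X → Set X → Prop}
    (mono : ∀ x Z Z', Z ⊆ Z' → Good x Z → Good x Z')
    (h : ∀ Z : Set X, (∀ x ∈ Z, Good x Z) → Z = ∅) :
    ∃ rk : X → Ordinal.{0}, ∀ x, ¬ Good x {y | rk x ≤ rk y} := by
  classical
  have hall : ∀ x, ∃ α, x ∈ deletedAt Good α := by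
    by_contra! hne
    obtain ⟨x₀, hx₀⟩ := hne
    let a : X → Ordinal.{0} := fun x => if hx : ∃ α, x ∈ deletedAt Good α then hx.choose else 0
    have hZ : {x | ∀ α, x ∉ deletedAt Good α} = ∅ := by
      apply h
      intro x hx
      have h1 := hx (Order.succ (⨆ y, a y))
      rw [mem_deletedAt, not_not] at h1
      refine mono _ _ _ ?_ h1
      intro y hy
      by_contra hy'
      have hex : ∃ α, y ∈ deletedAt Good α := by simpa using hy'
      have hay : y ∈ deletedAt Good (a y) := by
        simp only [a, dif_pos hex]; exact hex.choose_spec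
      exact hy (a y) (Order.lt_succ_of_le (Ordinal.le_iSup a y)) hay
    exact (Set.eq_empty_iff_forall_notMem.1 hZ x₀) hx₀
  refine ⟨fun x => sInf {α | x ∈ deletedAt Good α}, fun x hx => ?_⟩
  have h1 : x ∈ deletedAt Good (sInf {α | x ∈ deletedAt Good α}) := csInf_mem (hall x)
  rw [mem_deletedAt] at h1
  refine h1 (mono _ _ _ ?_ hx)
  intro y hy β hβ hyβ
  exact absurd (csInf_le' (s := {α | y ∈ deletedAt Good α}) hyβ) (not_le.2 (hβ.trans_le hy))

/-- The endpoints of paths of length at most `n` from `x` whose ranks are maximal at the end. -/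
def recordEnds {X : Type} (G : SimpleGraph X) (rk : X → Ordinal.{0}) (x : X) (n : ℕ) : Set X :=
  {y | ∃ m ≤ n, ∃ p, IsPathSeq G m p ∧ p 0 = x ∧ p m = y ∧ ∀ k ≤ m, rk (p k) ≤ rk y}

lemma IsPathSeq.drop {X : Type} {G : SimpleGraph X} {m k : ℕ} {p : ℕ → X}
    (hp : IsPathSeq G m p) (hk : k ≤ m) : IsPathSeq G (m - k) fun i => p (k + i) := by
  refine ⟨fun i hi j hj hij => ?_, fun i hi => hp.2 _ (by omega)⟩
  simp only [Set.mem_Iic] at hi hj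
  have := hp.1 (show k + i ∈ Set.Iic m by simp; omega) (show k + j ∈ Set.Iic m by simp; omega) hij
  omega

lemma finite_recordEnds {X : Type} {G : SimpleGraph X} {rk : X → Ordinal.{0}}
    (h : ∀ x n, 0 < n → ¬ FanTo G n x {y | rk x ≤ rk y}) (x : X) (n : ℕ) :
    (recordEnds G rk x n).Finite := by
  have h' : ∀ x n, ∃ S : Finset X, x ∉ S ∧ (0 < n → ∀ p, IsPathSeq G n p → p 0 = x →
      rk x ≤ rk (p n) → ∃ k ≤ n, p k ∈ S) := by
    intro x n
    rcases Nat.eq_zero_or_pos n with hn | hn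
    · exact ⟨∅, by simp, by omega⟩
    · have := h x n hn
      simp only [FanTo] at this
      push Not at this
      obtain ⟨S, hS, hp⟩ := this
      exact ⟨S, hS, fun _ => hp⟩
  choose S hxS hS using h'
  induction n generalizing x with
  | zero =>
    refine (Set.finite_singleton x).subset ?_
    rintro y ⟨m, hm, p, -, h0, hy, -⟩
    obtain rfl : m = 0 := by omega
    simp [← hy, h0]
  | succ n ih =>
    refine ((Set.finite_singleton x).union ((Set.finite_Iic (n + 1)).biUnion
      (t := fun m => ⋃ v ∈ (S x m : Set X), recordEnds G rk v n)
      fun m _ => (S x m).finite_toSet.biUnion fun v _ => ih v)).subset ?_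
    rintro y ⟨m, hm, p, hp, h0, hy, hrk⟩
    rcases Nat.eq_zero_or_pos m with rfl | hm0
    · left; simp [← hy, h0]
    · right
      obtain ⟨k, hk, hkS⟩ := hS x m hm0 p hp h0 (by rw [hy, ← h0]; exact hrk 0 (by omega))
      have hk0 : k ≠ 0 := by
        rintro rfl
        exact hxS x m (h0 ▸ hkS)
      simp only [Set.mem_iUnion]
      refine ⟨m, hm, p k, hkS, m - k, by omega, fun i => p (k + i), hp.drop hk, rfl, ?_, ?_⟩
      · simp only [Nat.add_sub_cancel' hk, hy]
      · intro i hi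
        exact hrk _ (by omega)

lemma exists_frequently_record {α : Type*} [LinearOrder α] [WellFoundedLT α] (r : ℕ → α) :
    ∃ i, ∃ᶠ j in atTop, i ≤ j ∧ ∀ k, i ≤ k → k ≤ j → r k ≤ r j := by
  by_contra! hcon
  have key : ∀ i, ∃ j₀ ≥ i, ∃ N, ∀ j ≥ N, r j < r j₀ := by
    intro i
    have hi := hcon i
    rw [eventually_atTop] at hi
    obtain ⟨N, hN⟩ := hi
    obtain ⟨j₀, hj₀, hmax⟩ := (Finset.Icc i (max i N)).exists_max_image r ⟨i, by simp⟩
    rw [Finset.mem_Icc] at hj₀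
    refine ⟨j₀, hj₀.1, max i N + 1, fun j => ?_⟩
    induction j using Nat.strong_induction_on with
    | _ j ih =>
      intro hj
      obtain ⟨k, hik, hkj, hlt⟩ := hN j (by omega) (by omega)
      rcases le_or_gt k (max i N) with hk | hk
      · exact hlt.trans_le (hmax k (by simp [hik]; omega))
      · have : k ≠ j := by rintro rfl; exact lt_irrefl _ hlt
        exact hlt.trans (ih k (by omega) hk)
  let A : Set α := {a | ∃ j₀, r j₀ = a ∧ ∃ N, ∀ j ≥ N, r j < r j₀}
  obtain ⟨j, -, hj⟩ := key 0
  obtain ⟨a, ⟨j₀, rfl, N, hN⟩, hmin⟩ := wellFounded_lt.has_min A ⟨r j, j, rfl, hj⟩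
  obtain ⟨j₁, hj₁, h1⟩ := key N
  exact hmin (r j₁) ⟨j₁, rfl, h1⟩ (hN j₁ hj₁)

lemma bddFamily_of_lt {F : Set (ℕ → ℕ)} (h : #F < bNum) : BddFamily F := by
  by_contra hF
  exact absurd (csInf_le' (s := {c | ∃ F : Set (ℕ → ℕ), ¬ BddFamily F ∧ #F = c}) ⟨F, hF, rfl⟩)
    (not_le.2 h)

lemma not_dominatingGraph_of_rank {X : Type} {G : SimpleGraph X} (hX : #X < bNum)
    {rk : X → Ordinal.{0}} (h : ∀ x n, 0 < n → ¬ FanTo G n x {y | rk x ≤ rk y}) :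
    ¬ DominatingGraph G := by
  rintro ⟨L, hL⟩
  let g : X → ℕ → ℕ := fun x n => (finite_recordEnds h x n).toFinset.sup L
  obtain ⟨f, hf⟩ : BddFamily (Set.range g) := bddFamily_of_lt (mk_range_le.trans_lt hX)
  obtain ⟨R, hR, hdom⟩ := hL fun n => f n + 1
  obtain ⟨i, hi⟩ := exists_frequently_record fun j => rk (R j)
  obtain ⟨j, ⟨hij, hrec⟩, h1, h2⟩ := (hi.and_eventually ((hf _ ⟨R i, rfl⟩).and hdom)).exists
  have h3 : L (R j) ≤ g (R i) j := by
    apply Finset.le_sup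
    rw [Set.Finite.mem_toFinset]
    refine ⟨j - i, by omega, fun k => R (i + k), ⟨fun a _ b _ hab => ?_, fun k _ => hR.2 _⟩, rfl,
      ?_, fun k hk => hrec _ (by omega) (by omega)⟩
    · have := hR.1 hab
      omega
    · simp only [Nat.add_sub_cancel' hij]
  simp only [Function.comp] at h2
  omega

lemma exists_fanClosed {X : Type} {G : SimpleGraph X} (hX : #X < bNum)
    (hG : DominatingGraph G) : ∃ Z : Set X, Z.Nonempty ∧ FanClosed G Z := by
  by_contra! hcon
  obtain ⟨rk, hrk⟩ := exists_rank (Good := fun x Z => ∃ n, 0 < n ∧ FanTo G n x Z)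
    (fun x Z Z' hZ ⟨n, hn, h⟩ => ⟨n, hn, h.mono hZ⟩)
    (fun Z hZ => by
      by_contra hne
      exact hcon Z (Set.nonempty_iff_ne_empty.2 hne) hZ)
  exact not_dominatingGraph_of_rank hX (fun x n hn hfan => hrk x ⟨n, hn, hfan⟩) hG

/-- Parent pointers describing a rooted tree in which the vertices with `rem v = 0` have infinitely
many children, all others have exactly one, and each vertex `w` is `rem w` steps above the next
vertex `v` with `rem v = 0`; `len v` is the number of steps from such a `v` to the next one. -/
structure ParentData (V : Type) where
  root : V
  par : V → V
  ht : V → ℕ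
  rem : V → ℕ
  len : V → ℕ
  par_root : par root = root
  ht_par : ∀ v, v ≠ root → ht (par v) < ht v
  rem_root : rem root = 0
  rem_of_eq_zero : ∀ w, w ≠ root → rem (par w) = 0 → rem w + 1 = len (par w)
  rem_of_ne_zero : ∀ w, w ≠ root → rem (par w) ≠ 0 → rem w + 1 = rem (par w)
  infinite_children : ∀ v, rem v = 0 → {w | w ≠ root ∧ par w = v}.Infinite
  existsUnique_child : ∀ v, rem v ≠ 0 → ∃! w, w ≠ root ∧ par w = v

namespace ParentData

/-- Transport of parent data along a bijection. -/
def map {V W : Type} (D : ParentData V) (e : V ≃ W) : ParentData W where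
  root := e D.root
  par w := e (D.par (e.symm w))
  ht w := D.ht (e.symm w)
  rem w := D.rem (e.symm w)
  len w := D.len (e.symm w)
  par_root := by simp [D.par_root]
  ht_par w hw := by
    simpa using D.ht_par (e.symm w) (by rwa [Ne, Equiv.symm_apply_eq])
  rem_root := by simp [D.rem_root]
  rem_of_eq_zero w hw := by
    simpa using D.rem_of_eq_zero (e.symm w) (by rwa [Ne, Equiv.symm_apply_eq])
  rem_of_ne_zero w hw := by
    simpa using D.rem_of_ne_zero (e.symm w) (by rwa [Ne, Equiv.symm_apply_eq])
  infinite_children v hv := by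
    refine ((D.infinite_children _ hv).image e.injective.injOn).mono ?_
    rintro _ ⟨w, ⟨hw, hp⟩, rfl⟩
    simp [hw, hp]
  existsUnique_child v hv := by
    obtain ⟨w, ⟨hw, hp⟩, hu⟩ := D.existsUnique_child _ hv
    refine ⟨e w, by simp [hw, hp], ?_⟩
    rintro y ⟨hy, hpy⟩
    rw [← Equiv.symm_apply_eq]
    refine hu _ ⟨by rwa [Ne, Equiv.symm_apply_eq], ?_⟩
    rw [← hpy, Equiv.symm_apply_apply]

variable {V : Type} (D : ParentData V)

/-- The tree with the given parent pointers. -/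
def tree : SimpleGraph V := SimpleGraph.fromRel fun a b => D.par a = b

lemma par_ne {v : V} (hv : v ≠ D.root) : D.par v ≠ v := fun h => by
  have := D.ht_par v hv
  rw [h] at this
  exact lt_irrefl _ this

lemma ht_par_le (v : V) : D.ht (D.par v) ≤ D.ht v := by
  by_cases hv : v = D.root
  · rw [hv, D.par_root]
  · exact (D.ht_par v hv).le

lemma tree_adj {a b : V} :
    D.tree.Adj a b ↔ (a ≠ D.root ∧ D.par a = b) ∨ (b ≠ D.root ∧ D.par b = a) := by
  simp only [tree, SimpleGraph.fromRel_adj]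
  constructor
  · rintro ⟨hne, h | h⟩
    · refine Or.inl ⟨?_, h⟩
      rintro rfl
      exact hne (D.par_root.symm.trans h)
    · refine Or.inr ⟨?_, h⟩
      rintro rfl
      exact hne (h.symm.trans D.par_root)
  · rintro (⟨ha, rfl⟩ | ⟨hb, rfl⟩)
    · exact ⟨(D.par_ne ha).symm, Or.inl rfl⟩
    · exact ⟨D.par_ne hb, Or.inr rfl⟩

lemma adj_par {v : V} (hv : v ≠ D.root) : D.tree.Adj v (D.par v) := D.tree_adj.2 (Or.inl ⟨hv, rfl⟩)

lemma reachable_root (v : V) : D.tree.Reachable v D.root := by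
  induction hn : D.ht v using Nat.strong_induction_on generalizing v with
  | _ n ih =>
    by_cases hv : v = D.root
    · rw [hv]
    · exact (D.adj_par hv).reachable.trans (ih _ (hn ▸ D.ht_par v hv) _ rfl)

lemma ht_iterate_par_le (k : ℕ) (v : V) : D.ht (D.par^[k] v) ≤ D.ht v := by
  induction k with
  | zero => rfl
  | succ k ih => rw [Function.iterate_succ_apply']; exact (D.ht_par_le _).trans ih

lemma isBridge_par {v : V} (hv : v ≠ D.root) : D.tree.IsBridge s(v, D.par v) := by
  rw [SimpleGraph.isBridge_iff]
  rintro ⟨W⟩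
  have key : ∀ {a b : V}, (D.tree \ SimpleGraph.fromEdgeSet {s(v, D.par v)}).Walk a b →
      (∃ k, D.par^[k] a = v) → ∃ k, D.par^[k] b = v := by
    intro a b W
    induction W with
    | nil => exact id
    | @cons a c b h _ ih =>
      rintro ⟨k, hk⟩
      apply ih
      rw [SimpleGraph.sdiff_adj, D.tree_adj] at h
      obtain ⟨⟨ha, rfl⟩ | ⟨hc, rfl⟩, hne⟩ := h
      · cases k with
        | zero =>
          obtain rfl : a = v := hk
          exact absurd (by simp [(D.par_ne ha).symm]) hne
        | succ k => exact ⟨k, hk⟩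
      · exact ⟨k + 1, hk⟩
  obtain ⟨k, hk⟩ := key W ⟨0, rfl⟩
  have h1 := D.ht_iterate_par_le k (D.par v)
  rw [hk] at h1
  exact absurd (D.ht_par v hv) (not_lt.2 h1)

lemma isTree : D.tree.IsTree where
  connected :=
    { preconnected := fun u v => (D.reachable_root u).trans (D.reachable_root v).symm
      nonempty := ⟨D.root⟩ }
  isAcyclic := by
    rw [SimpleGraph.isAcyclic_iff_forall_adj_isBridge]
    intro v w h
    obtain ⟨hv, rfl⟩ | ⟨hw, rfl⟩ := D.tree_adj.1 h
    · exact D.isBridge_par hv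
    · rw [Sym2.eq_swap]
      exact D.isBridge_par hw

lemma card_neighborSet_eq_two {v : V} (hv : D.rem v ≠ 0) : #(D.tree.neighborSet v) = 2 := by
  have hvr : v ≠ D.root := by
    rintro rfl
    exact hv D.rem_root
  obtain ⟨c, ⟨hc, rfl⟩, hu⟩ := D.existsUnique_child v hv
  have : D.tree.neighborSet (D.par c) = {D.par (D.par c), c} := by
    ext w
    simp only [SimpleGraph.mem_neighborSet, D.tree_adj, Set.mem_insert_iff, Set.mem_singleton_iff]
    constructor
    · rintro (⟨-, rfl⟩ | h)
      · exact Or.inl rfl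
      · exact Or.inr (hu w h)
    · rintro (rfl | rfl)
      · exact Or.inl ⟨hvr, rfl⟩
      · exact Or.inr ⟨hc, rfl⟩
  rw [this, Cardinal.mk_insert, Cardinal.mk_singleton, one_add_one_eq_two]
  rintro h
  have h1 := D.ht_par _ hvr
  have h2 := D.ht_par _ hc
  rw [Set.mem_singleton_iff] at h
  rw [h] at h1
  omega

lemma branchVtx_iff [Countable V] {v : V} : BranchVtx D.tree v ↔ D.rem v = 0 := by
  constructor
  · intro h
    by_contra hv
    rw [BranchVtx, D.card_neighborSet_eq_two hv] at h
    exact (Cardinal.ofNat_lt_aleph0 (n := 2)).ne h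
  · intro hv
    have hinf : (D.tree.neighborSet v).Infinite :=
      (D.infinite_children v hv).mono fun w hw => D.tree_adj.2 (Or.inr hw)
    have := hinf.to_subtype
    exact Cardinal.mk_eq_aleph0 _

lemma down_of_down {p : ℕ → V} {i : ℕ} (hp : p i ≠ p (i + 2))
    (hadj : D.tree.Adj (p (i + 1)) (p (i + 2)))
    (h : p (i + 1) ≠ D.root ∧ D.par (p (i + 1)) = p i) :
    p (i + 2) ≠ D.root ∧ D.par (p (i + 2)) = p (i + 1) := by
  obtain h' | h' := D.tree_adj.1 hadj
  · exact absurd (h.2.symm.trans h'.2) hp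
  · exact h'

lemma exists_branch_of_isRay {R : ℕ → V} (hR : IsRay D.tree R) : ∃ n, D.rem (R n) = 0 := by
  by_contra! hcon
  by_cases hdown : ∃ n, R (n + 1) ≠ D.root ∧ D.par (R (n + 1)) = R n
  · obtain ⟨n, hn⟩ := hdown
    have hall : ∀ k, (R (n + k + 1) ≠ D.root ∧ D.par (R (n + k + 1)) = R (n + k)) ∧
        D.rem (R (n + k)) + k = D.rem (R n) := by
      intro k
      induction k with
      | zero => exact ⟨hn, rfl⟩
      | succ k ih =>
        refine ⟨D.down_of_down (fun h => ?_) (hR.2 _) ih.1, ?_⟩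
        · have := hR.1 h
          omega
        · have h1 := D.rem_of_ne_zero _ ih.1.1 (by rw [ih.1.2]; exact hcon _)
          rw [ih.1.2] at h1
          rw [← ih.2, ← h1, ← add_assoc n k 1]
          omega
    have := (hall (D.rem (R n) + 1)).2
    omega
  · have hup : ∀ n, D.ht (R n) + n ≤ D.ht (R 0) := by
      intro n
      induction n with
      | zero => rfl
      | succ n ih =>
        obtain ⟨h1, h2⟩ | h := D.tree_adj.1 (hR.2 n)
        · have := D.ht_par _ h1
          rw [h2] at this
          omega
        · exact absurd ⟨n, h⟩ hdown
    have := hup (D.ht (R 0) + 1)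
    omega

lemma exists_path_root (v : V) : ∃ P : D.tree.Walk v D.root, P.IsPath ∧
    (∀ u ∈ P.support, D.ht u ≤ D.ht v) ∧ ∀ k, D.par^[k] v ∈ P.support := by
  induction hn : D.ht v using Nat.strong_induction_on generalizing v with
  | _ n ih =>
    subst hn
    by_cases hv : v = D.root
    · subst hv
      refine ⟨.nil, by simp, by simp, fun k => ?_⟩
      simp [Function.iterate_fixed D.par_root]
    · obtain ⟨P, hP, hht, hmem⟩ := ih _ (D.ht_par v hv) _ rfl
      refine ⟨.cons (D.adj_par hv) P, ?_, ?_, ?_⟩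
      · rw [SimpleGraph.Walk.cons_isPath_iff]
        exact ⟨hP, fun h => absurd (hht v h) (not_le.2 (D.ht_par v hv))⟩
      · intro u hu
        rw [SimpleGraph.Walk.support_cons, List.mem_cons] at hu
        obtain rfl | hu := hu
        · rfl
        · exact (hht u hu).trans (D.ht_par_le v)
      · intro k
        rw [SimpleGraph.Walk.support_cons, List.mem_cons]
        cases k with
        | zero => exact Or.inl rfl
        | succ k => exact Or.inr (hmem k)

lemma length_of_subdividedEdge [Countable V] {x y : V} {W : D.tree.Walk x y}
    (hW : SubdividedEdge D.tree W) (hy : ∀ P : D.tree.Walk x D.root, P.IsPath → y ∉ P.support) :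
    W.length = D.len x := by
  obtain ⟨hpath, hx, hyb, hpos, hinner⟩ := hW
  rw [D.branchVtx_iff] at hx hyb
  have hinj := hpath.getVert_injOn
  have hadj : ∀ i < W.length, D.tree.Adj (W.getVert i) (W.getVert (i + 1)) :=
    fun i hi => W.adj_getVert_succ hi
  have hne : ∀ i ≤ W.length, ∀ j ≤ W.length, i ≠ j → W.getVert i ≠ W.getVert j :=
    fun i hi j hj hij h => hij (hinj hi hj h)
  have hrem : ∀ i, 0 < i → i < W.length → D.rem (W.getVert i) ≠ 0 := by
    intro i h0 hi
    have := hinner (W.getVert i) (W.getVert_mem_support i)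
      (by simpa using hne i (by omega) 0 (by omega) (by omega))
      (by simpa using hne i (by omega) W.length (by omega) (by omega))
    rwa [D.branchVtx_iff] at this
  by_cases hfirst : W.getVert 1 ≠ D.root ∧ D.par (W.getVert 1) = W.getVert 0
  · have hall : ∀ k, k < W.length →
        (W.getVert (k + 1) ≠ D.root ∧ D.par (W.getVert (k + 1)) = W.getVert k) ∧
          D.rem (W.getVert (k + 1)) + (k + 1) = D.len x := by
      intro k
      induction k with
      | zero =>
        intro _
        refine ⟨hfirst, ?_⟩
        have h1 := D.rem_of_eq_zero _ hfirst.1 (by rw [hfirst.2]; simpa using hx)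
        rw [hfirst.2] at h1
        simpa using h1
      | succ k ih =>
        intro hk
        obtain ⟨hd, hr⟩ := ih (by omega)
        have hd' := D.down_of_down (p := W.getVert)
          (hne k (by omega) (k + 2) (by omega) (by omega)) (hadj _ hk) hd
        refine ⟨hd', ?_⟩
        have h1 := D.rem_of_ne_zero _ hd'.1 (by rw [hd'.2]; exact hrem _ (by omega) (by omega))
        rw [hd'.2] at h1
        change D.rem (W.getVert (k + 2)) + (k + 2) = _
        omega
    have h1 := (hall (W.length - 1) (by omega)).2
    rw [Nat.sub_add_cancel hpos, W.getVert_length, hyb] at h1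
    omega
  · exfalso
    have hall : ∀ k, k < W.length →
        (W.getVert k ≠ D.root ∧ D.par (W.getVert k) = W.getVert (k + 1)) ∧
          D.par^[k + 1] x = W.getVert (k + 1) := by
      intro k
      induction k with
      | zero =>
        intro _
        obtain h | h := D.tree_adj.1 (hadj 0 hpos)
        · exact ⟨h, by simpa using h.2⟩
        · exact absurd h hfirst
      | succ k ih =>
        intro hk
        obtain ⟨hu, hit⟩ := ih (by omega)
        obtain h | h := D.tree_adj.1 (hadj _ hk)
        · exact ⟨h, by rw [Function.iterate_succ_apply', hit, h.2]⟩
        · obtain ⟨c, -, hc⟩ := D.existsUnique_child _ (hrem (k + 1) (by omega) hk)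
          exact absurd ((hc _ hu).trans (hc _ h).symm)
            (hne k (by omega) (k + 2) (by omega) (by omega))
    obtain ⟨P, hP, -, hmem⟩ := D.exists_path_root x
    have h1 := (hall (W.length - 1) (by omega)).2
    rw [Nat.sub_add_cancel hpos, W.getVert_length] at h1
    exact hy P hP (h1 ▸ hmem _)

lemma uniformSubdivTOmega [Countable V] : UniformSubdivTOmega D.tree := by
  refine ⟨⟨D.isTree, fun v => ?_, fun R hR => ?_⟩, D.root, D.branchVtx_iff.2 D.rem_root, ?_⟩
  · by_cases hv : D.rem v = 0
    · exact Or.inr (D.branchVtx_iff.2 hv)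
    · exact Or.inl (D.card_neighborSet_eq_two hv)
  · obtain ⟨n, hn⟩ := D.exists_branch_of_isRay hR
    exact ⟨n, D.branchVtx_iff.2 hn⟩
  · intro x y z W W' hW hW' hy hz
    rw [D.length_of_subdividedEdge hW hy, D.length_of_subdividedEdge hW' hz]

end ParentData

/-- The model of a uniform subdivision of `T_ω` made of segments `{m} × {0, …, ℓ m - 1}`, where
segment `m + 1` hangs from the end of segment `(Nat.unpair m).1`. -/
def segmentData (ℓ N : ℕ → ℕ) (h0 : ℓ 0 = 1) (hN : ∀ m, 0 < N m)
    (hℓ : ∀ m, ℓ (m + 1) = N (Nat.unpair m).1) : ParentData {x : ℕ × ℕ // x.2 < ℓ x.1} :=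
  have hpos : ∀ m, 0 < ℓ m
    | 0 => by omega
    | m + 1 => by rw [hℓ]; exact hN _
  { root := ⟨(0, 0), hpos 0⟩
    par := fun x => match x with
      | ⟨(0, 0), _⟩ => ⟨(0, 0), hpos 0⟩
      | ⟨(m + 1, 0), _⟩ => ⟨((Nat.unpair m).1, ℓ (Nat.unpair m).1 - 1), Nat.sub_one_lt (hpos _).ne'⟩
      | ⟨(m, k + 1), h⟩ => ⟨(m, k), (Nat.lt_succ_self k).trans h⟩
    ht := fun x => ∑ i ∈ Finset.range x.1.1, ℓ i + x.1.2
    rem := fun x => ℓ x.1.1 - 1 - x.1.2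
    len := fun x => N x.1.1
    par_root := rfl
    ht_par := by
      rintro ⟨⟨_ | m, _ | k⟩, h⟩ hne
      · exact absurd rfl hne
      · simp
      · simp only [add_zero]
        have h1 : ∑ i ∈ Finset.range ((Nat.unpair m).1 + 1), ℓ i ≤
            ∑ i ∈ Finset.range (m + 1), ℓ i :=
          Finset.sum_le_sum_of_subset
            (Finset.range_mono (Nat.succ_le_succ (Nat.unpair_left_le m)))
        have h2 := hpos (Nat.unpair m).1
        rw [Finset.sum_range_succ] at h1
        omega
      · simp
    rem_root := by simp [h0]
    rem_of_eq_zero := by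
      rintro ⟨⟨_ | m, _ | k⟩, h⟩ hne hr
      · exact absurd rfl hne
      · simp only at h hr ⊢; omega
      · simp only at h hr ⊢
        rw [← hℓ]
        omega
      · simp only [Nat.succ_eq_add_one] at h hr ⊢; omega
    rem_of_ne_zero := by
      rintro ⟨⟨_ | m, _ | k⟩, h⟩ hne hr
      · exact absurd rfl hne
      · simp only at h hr ⊢; omega
      · simp only at h hr ⊢; omega
      · simp only [Nat.succ_eq_add_one] at h hr ⊢; omega
    infinite_children := by
      rintro ⟨⟨m, k⟩, h⟩ hr
      simp only at h hr
      refine Set.infinite_of_injective_forall_mem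
        (f := fun j : ℕ => (⟨(Nat.pair m j + 1, 0), hpos _⟩ : {x : ℕ × ℕ // x.2 < ℓ x.1})) ?_ ?_
      · intro i j hij
        simp only [Subtype.mk.injEq, Prod.mk.injEq, add_left_inj, and_true] at hij
        exact (Nat.pair_eq_pair.1 hij).2
      · intro j
        simp only [Set.mem_ofPred_eq, ne_eq, Subtype.mk.injEq, Prod.mk.injEq, Nat.unpair_pair]
        refine ⟨by omega, trivial, by omega⟩
    existsUnique_child := by
      rintro ⟨⟨m, k⟩, h⟩ hr
      simp only at h hr
      refine ⟨⟨(m, k + 1), by simp only; omega⟩, ⟨by simp, ?_⟩, ?_⟩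
      · cases m <;> rfl
      · rintro ⟨⟨_ | m', _ | k'⟩, h'⟩ ⟨hne, hp⟩
        · exact absurd rfl hne
        · simp only [Subtype.mk.injEq, Prod.mk.injEq] at hp ⊢
          obtain ⟨rfl, rfl⟩ := hp
          exact ⟨rfl, rfl⟩
        · simp only [Subtype.mk.injEq, Prod.mk.injEq] at hp ⊢
          obtain ⟨rfl, rfl⟩ := hp
          omega
        · simp only [Subtype.mk.injEq, Prod.mk.injEq] at hp ⊢
          obtain ⟨rfl, rfl⟩ := hp
          exact ⟨rfl, rfl⟩ }

lemma adj_of_segmentData_adj {X : Type} {G : SimpleGraph X} {ℓ N : ℕ → ℕ} (h0 : ℓ 0 = 1)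
    (hN : ∀ m, 0 < N m) (hℓ : ∀ m, ℓ (m + 1) = N (Nat.unpair m).1) {q : ℕ → ℕ → X}
    (hq : ∀ m k, k + 1 < ℓ m → G.Adj (q m k) (q m (k + 1)))
    (hq' : ∀ m, G.Adj (q (Nat.unpair m).1 (ℓ (Nat.unpair m).1 - 1)) (q (m + 1) 0))
    {a b : {x : ℕ × ℕ // x.2 < ℓ x.1}} (hab : (segmentData ℓ N h0 hN hℓ).tree.Adj a b) :
    G.Adj (q a.1.1 a.1.2) (q b.1.1 b.1.2) := by
  have key : ∀ a : {x : ℕ × ℕ // x.2 < ℓ x.1}, a ≠ (segmentData ℓ N h0 hN hℓ).root →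
      G.Adj (q a.1.1 a.1.2) (q ((segmentData ℓ N h0 hN hℓ).par a).1.1
        ((segmentData ℓ N h0 hN hℓ).par a).1.2) := by
    rintro ⟨⟨_ | m, _ | k⟩, h⟩ hne
    · exact absurd rfl hne
    · exact (hq _ _ h).symm
    · exact (hq' m).symm
    · exact (hq _ _ h).symm
  obtain ⟨ha, rfl⟩ | ⟨hb, rfl⟩ := (ParentData.tree_adj _).1 hab
  · exact key a ha
  · exact (key b hb).symm

lemma exists_uniformSubdiv_of_injective {V X : Type} [Countable V] {G : SimpleGraph X}
    (D : ParentData V) {φ : V → X} (hφ : Function.Injective φ)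
    (hadj : ∀ a b, D.tree.Adj a b → G.Adj (φ a) (φ b)) :
    ∃ (s : Set X) (T : SimpleGraph s), T ≤ G.induce s ∧ UniformSubdivTOmega T := by
  let e : V ≃ Set.range φ := Equiv.ofInjective φ hφ
  have : Countable (Set.range φ) := e.symm.injective.countable
  refine ⟨Set.range φ, (D.map e).tree, ?_, (D.map e).uniformSubdivTOmega⟩
  have key : ∀ a : Set.range φ, a ≠ (D.map e).root → G.Adj a.1 ((D.map e).par a).1 := by
    intro a ha
    obtain ⟨v, rfl⟩ := e.surjective a
    have hv : v ≠ D.root := fun h => ha (by rw [h]; rfl)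
    have h1 : (D.map e).par (e v) = e (D.par v) := by simp [ParentData.map]
    rw [h1]
    exact hadj _ _ (D.adj_par hv)
  intro a b hab
  obtain ⟨ha, rfl⟩ | ⟨hb, rfl⟩ := (ParentData.tree_adj _).1 hab
  · exact key a ha
  · exact (key b hb).symm

lemma FanClosed.exists_paths {X : Type} {G : SimpleGraph X} {Z : Set X} (hne : Z.Nonempty)
    (hZ : FanClosed G Z) : ∃ (len : X → ℕ) (E : ℕ → X) (U : ℕ → Finset X) (p : ℕ → ℕ → X),
      (∀ m, 0 < len (E m)) ∧ (∀ m, E m ∈ U m) ∧ Monotone U ∧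
      ∀ m, IsPathSeq G (len (E (Nat.unpair m).1)) (p m) ∧ p m 0 = E (Nat.unpair m).1 ∧
        p m (len (E (Nat.unpair m).1)) = E (m + 1) ∧
        ∀ k, 0 < k → k ≤ len (E (Nat.unpair m).1) → p m k ∉ U m ∧ p m k ∈ U (m + 1) := by
  classical
  obtain ⟨z₀, hz₀⟩ := hne
  have hfan : ∀ x, ∃ n, x ∈ Z → 0 < n ∧ FanTo G n x Z := by
    intro x
    by_cases hx : x ∈ Z
    · obtain ⟨n, hn⟩ := hZ x hx
      exact ⟨n, fun _ => hn⟩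
    · exact ⟨0, fun h => absurd h hx⟩
  choose len hlen using hfan
  have hstep : ∀ (U : Finset X) (z : Z), ∃ p : ℕ → X, IsPathSeq G (len z) p ∧ p 0 = z ∧
      p (len z) ∈ Z ∧ ∀ k, 0 < k → k ≤ len z → p k ∉ U := by
    intro U z
    obtain ⟨p, hp, h0, hn, hk⟩ := (hlen z z.2).2 (U.erase z) (by simp)
    refine ⟨p, hp, h0, hn, fun k hk0 hkn hkU => hk k hkn (Finset.mem_erase.2 ⟨?_, hkU⟩)⟩
    rw [← h0]
    intro h
    have := hp.1 (Set.mem_Iic.2 hkn) (Set.mem_Iic.2 (Nat.zero_le _)) h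
    omega
  choose path hpath hpath0 hpathZ hpathU using hstep
  let st : ℕ → Finset X × (ℕ → Z) := Nat.rec ({z₀}, fun _ => ⟨z₀, hz₀⟩) fun m s =>
    (s.1 ∪ (Finset.range (len (s.2 (Nat.unpair m).1) + 1)).image (path s.1 (s.2 (Nat.unpair m).1)),
      Function.update s.2 (m + 1) ⟨_, hpathZ s.1 (s.2 (Nat.unpair m).1)⟩)
  have hst₁ : ∀ m, (st (m + 1)).1 = (st m).1 ∪
      (Finset.range (len ((st m).2 (Nat.unpair m).1) + 1)).image
        (path (st m).1 ((st m).2 (Nat.unpair m).1)) := fun m => rfl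
  have hst₂ : ∀ m, (st (m + 1)).2 = Function.update (st m).2 (m + 1)
      ⟨_, hpathZ (st m).1 ((st m).2 (Nat.unpair m).1)⟩ := fun m => rfl
  have hstable : ∀ m i, i ≤ m → (st m).2 i = (st i).2 i := by
    intro m i him
    induction m, him using Nat.le_induction with
    | base => rfl
    | succ m hm ih => rw [hst₂, Function.update_of_ne (by omega), ih]
  have hpar : ∀ m, (st m).2 (Nat.unpair m).1 = (st (Nat.unpair m).1).2 (Nat.unpair m).1 :=
    fun m => hstable m _ (Nat.unpair_left_le m)
  have hmem : ∀ m k, k ≤ len ((st m).2 (Nat.unpair m).1) →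
      path (st m).1 ((st m).2 (Nat.unpair m).1) k ∈ (st (m + 1)).1 := by
    intro m k hk
    rw [hst₁]
    exact Finset.mem_union_right _ (Finset.mem_image_of_mem _ (Finset.mem_range.2 (by omega)))
  refine ⟨len, fun m => (st m).2 m, fun m => (st m).1,
    fun m => path (st m).1 ((st m).2 (Nat.unpair m).1), fun m => (hlen _ (Subtype.prop _)).1,
    ?_, ?_, ?_⟩
  · rintro (_ | m)
    · exact Finset.mem_singleton_self z₀
    · have h1 : ((st (m + 1)).2 (m + 1) : X) = path (st m).1 ((st m).2 (Nat.unpair m).1)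
          (len ((st m).2 (Nat.unpair m).1)) := by
        rw [hst₂, Function.update_self]
      simp only [h1]
      exact hmem m _ le_rfl
  · exact monotone_nat_of_le_succ fun m => by
      simp only [hst₁]
      exact Finset.subset_union_left
  · intro m
    simp only [← hpar]
    refine ⟨hpath _ _, hpath0 _ _, ?_, fun k hk0 hk => ⟨hpathU _ _ k hk0 hk, hmem m k hk⟩⟩
    rw [hst₂, Function.update_self]

lemma FanClosed.exists_uniformSubdiv {X : Type} {G : SimpleGraph X} {Z : Set X}
    (hne : Z.Nonempty) (hZ : FanClosed G Z) :
    ∃ (s : Set X) (T : SimpleGraph s), T ≤ G.induce s ∧ UniformSubdivTOmega T := by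
  obtain ⟨len, E, U, p, hlen, hEU, hU, hp⟩ := hZ.exists_paths hne
  let N : ℕ → ℕ := fun m => len (E m)
  let ℓ : ℕ → ℕ := fun
    | 0 => 1
    | m + 1 => N (Nat.unpair m).1
  let q : ℕ → ℕ → X := fun
    | 0, _ => E 0
    | m + 1, k => p m (k + 1)
  have hqU : ∀ m k, k < ℓ m → q m k ∈ U m := by
    rintro (_ | m) k hk
    · exact hEU 0
    · exact ((hp m).2.2.2 (k + 1) (by omega) hk).2
  have hend : ∀ m, q m (ℓ m - 1) = E m := by
    rintro (_ | m)
    · rfl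
    · change p m (N _ - 1 + 1) = _
      rw [Nat.sub_add_cancel (hlen _)]
      exact (hp m).2.2.1
  have hlt : ∀ m m' k k', m < m' → k < ℓ m → k' < ℓ m' → q m k ≠ q m' k' := by
    rintro m (_ | m') k k' hm hk hk' h
    · omega
    · refine ((hp m').2.2.2 (k' + 1) (by omega) hk').1 (hU (Nat.lt_succ_iff.1 hm) ?_)
      change q (m' + 1) k' ∈ U m
      exact h ▸ hqU m k hk
  have hℓ : ∀ m, ℓ (m + 1) = N (Nat.unpair m).1 := fun _ => rfl
  refine exists_uniformSubdiv_of_injective (segmentData ℓ N rfl hlen hℓ)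
    (φ := fun a => q a.1.1 a.1.2) ?_ fun a b => adj_of_segmentData_adj rfl hlen hℓ ?_ ?_
  · rintro ⟨⟨m, k⟩, hk⟩ ⟨⟨m', k'⟩, hk'⟩ h
    simp only at hk hk' h
    obtain hm | rfl | hm := lt_trichotomy m m'
    · exact absurd h (hlt _ _ _ _ hm hk hk')
    · rcases m with _ | m
      · obtain rfl : k = 0 := Nat.lt_one_iff.1 hk
        obtain rfl : k' = 0 := Nat.lt_one_iff.1 hk'
        rfl
      · have := (hp m).1.1 (Set.mem_Iic.2 hk) (Set.mem_Iic.2 hk') h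
        obtain rfl : k = k' := by omega
        rfl
    · exact absurd h.symm (hlt _ _ _ _ hm hk' hk)
  · rintro (_ | m) k hk
    · exact absurd (Nat.lt_one_iff.1 hk) (by omega)
    · exact (hp m).1.2 (k + 1) hk
  · intro m
    rw [hend, ← (hp m).2.1]
    exact (hp m).1.2 0 (hlen _)

/-- If a dominating graph has fewer than 𝔟 vertices, it contains a uniform subdivision
of `T_ω`. -/
theorem stmt8 {X : Type} (G : SimpleGraph X) (hX : #X < bNum)
    (hG : DominatingGraph G) :
    ∃ (s : Set X) (T : SimpleGraph s), T ≤ G.induce s ∧ UniformSubdivTOmega T := by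
  obtain ⟨Z, hne, hZ⟩ := exists_fanClosed hX hG
  exact hZ.exists_uniformSubdiv hne
end

section
/- Let G be a graph on X and ρ a rank function where ρ(x) is the least ξ with x ∈ Σ_ξ (Σ_0 = vertices of finite degree, Σ_ξ = vertices x such that for every m, every family of disjoint paths of length m from x ending outside ⋃_{ζ<ξ} Σ_ζ is finite). If ρ(x) is undefined for some x ∈ X, then G contains a uniform subdivision of T_ω. -/
open Filter Cardinal

namespace SimpleGraph

variable {V : Type}

/-- A rooted tree given by a parent function, whose vertices are arranged into segments: the
vertex `v` is the `pos v`-th vertex of a segment of length `len v`, and the vertices at the ends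
of segments, forming `B`, are those from which new segments branch off, all of the same length. -/
structure IsSegmentTree {D : Type} [LinearOrder D] (T : SimpleGraph V) (r : V) (par : V → V)
    (d : V → D) (B : Set V) (pos len ell : V → ℕ) : Prop where
  adj_iff : ∀ u v, T.Adj u v ↔ (u ≠ r ∧ par u = v) ∨ (v ≠ r ∧ par v = u)
  par_lt : ∀ v, v ≠ r → d (par v) < d v
  root_mem : r ∈ B
  infinite_children : ∀ v ∈ B, {c | c ≠ r ∧ par c = v}.Infinite
  unique_child : ∀ v ∉ B, ∃ c, c ≠ r ∧ par c = v ∧ ∀ c', c' ≠ r → par c' = v → c' = c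
  pos_of_mem : ∀ v, v ≠ r → par v ∈ B → pos v = 1 ∧ len v = ell (par v)
  pos_of_notMem : ∀ v, v ≠ r → par v ∉ B → pos v = pos (par v) + 1 ∧ len v = len (par v)
  pos_le : ∀ v, pos v ≤ len v
  pos_eq : ∀ v ∈ B, pos v = len v

namespace IsSegmentTree

variable {D : Type} [LinearOrder D] {T : SimpleGraph V} {r : V} {par : V → V}
  {d : V → D} {B : Set V} {pos len ell : V → ℕ}

theorem adj_par (h : IsSegmentTree T r par d B pos len ell) {v : V} (hv : v ≠ r) :
    T.Adj v (par v) := (h.adj_iff _ _).2 (Or.inl ⟨hv, rfl⟩)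

theorem exists_rootPath [WellFoundedLT D] (h : IsSegmentTree T r par d B pos len ell) (u : V) :
    ∃ P : T.Walk u r, P.IsPath ∧ ∀ v ∈ P.support, d v ≤ d u := by
  induction hu : d u using WellFoundedLT.induction generalizing u with
  | ind x ih =>
    subst hu
    by_cases hr : u = r
    · subst hr
      exact ⟨.nil, by simp, by simp⟩
    · obtain ⟨P, hP, hd⟩ := ih _ (h.par_lt u hr) (par u) rfl
      refine ⟨.cons (h.adj_par hr) P, ?_, ?_⟩
      · rw [Walk.cons_isPath_iff]
        exact ⟨hP, fun hm => absurd (hd _ hm) (not_le.2 (h.par_lt u hr))⟩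
      · intro v hv
        rw [Walk.support_cons, List.mem_cons] at hv
        rcases hv with rfl | hv
        · exact le_rfl
        · exact (hd v hv).trans (h.par_lt u hr).le

theorem eq_par_of_adj (h : IsSegmentTree T r par d B pos len ell) {u v : V} (ha : T.Adj u v)
    (hd : d v ≤ d u) : v = par u := by
  rcases (h.adj_iff _ _).1 ha with ⟨-, h1⟩ | ⟨h1, h2⟩
  · exact h1.symm
  · have := h.par_lt v h1
    rw [h2] at this
    exact absurd this (not_lt.2 hd)

theorem isTree [WellFoundedLT D] (h : IsSegmentTree T r par d B pos len ell) : T.IsTree := by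
  classical
  refine ⟨(connected_iff _).2 ⟨fun u v => ?_, ⟨r⟩⟩, ?_⟩
  · obtain ⟨P, -⟩ := h.exists_rootPath u
    obtain ⟨Q, -⟩ := h.exists_rootPath v
    exact ⟨P.append Q.reverse⟩
  · intro v c hc
    obtain ⟨u, hu, hmax⟩ := c.support.toFinset.exists_max_image d ⟨v, by simp⟩
    rw [List.mem_toFinset] at hu
    have hc' := hc.rotate hu
    have hle : ∀ w ∈ (c.rotate u hu).support, d w ≤ d u := by
      intro w hw
      apply hmax
      rw [List.mem_toFinset]
      exact (c.mem_support_rotate_iff u hu).1 hw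
    have hn : ¬ (c.rotate u hu).Nil := hc'.not_nil
    apply hc'.snd_ne_penultimate
    rw [h.eq_par_of_adj (Walk.adj_snd hn) (hle _ (Walk.getVert_mem_support _ _)),
      h.eq_par_of_adj (Walk.adj_penultimate hn).symm (hle _ (Walk.getVert_mem_support _ _))]

theorem neighborSet_of_notMem (h : IsSegmentTree T r par d B pos len ell) {v : V} (hv : v ∉ B) :
    #(T.neighborSet v) = 2 := by
  have hr : v ≠ r := fun e => hv (e ▸ h.root_mem)
  obtain ⟨c, hc, hcv, hu⟩ := h.unique_child v hv
  have hne : par v ≠ c := by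
    rintro rfl
    have h1 := h.par_lt _ hr
    have h2 := h.par_lt _ hc
    rw [hcv] at h2
    exact lt_asymm h1 h2
  have : T.neighborSet v = {par v, c} := by
    ext w
    rw [mem_neighborSet, h.adj_iff]
    constructor
    · rintro (⟨-, rfl⟩ | ⟨h1, h2⟩)
      · simp
      · simp [hu w h1 h2]
    · rintro (rfl | rfl)
      · exact Or.inl ⟨hr, rfl⟩
      · exact Or.inr ⟨hc, hcv⟩
  rw [this, Cardinal.mk_insert (by simpa using hne), Cardinal.mk_singleton]
  norm_num

theorem branchVtx_iff [Countable V] (h : IsSegmentTree T r par d B pos len ell) (v : V) :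
    BranchVtx T v ↔ v ∈ B := by
  constructor
  · intro hb
    by_contra hv
    have h2 := h.neighborSet_of_notMem hv
    rw [BranchVtx, h2] at hb
    exact (Cardinal.natCast_lt_aleph0 (n := 2)).ne (by exact_mod_cast hb)
  · intro hv
    have hinf : (T.neighborSet v).Infinite :=
      (h.infinite_children v hv).mono fun c hc => (h.adj_iff _ _).2 (Or.inr hc)
    have := hinf.to_subtype
    exact Cardinal.mk_eq_aleph0 _

theorem exists_mem_of_isRay [WellFoundedLT D] (h : IsSegmentTree T r par d B pos len ell)
    {R : ℕ → V} (hR : IsRay T R) : ∃ n, R n ∈ B := by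
  by_contra! hB
  have hstep : ∀ n, (R n ≠ r ∧ par (R n) = R (n + 1)) ∨
      (R (n + 1) ≠ r ∧ par (R (n + 1)) = R n) := fun n => (h.adj_iff _ _).1 (hR.2 n)
  obtain ⟨n, hn⟩ : ∃ n, R (n + 1) ≠ r ∧ par (R (n + 1)) = R n := by
    by_contra! hno
    have hlt : ∀ n, d (R (n + 1)) < d (R n) := by
      intro n
      rcases hstep n with ⟨h1, h2⟩ | ⟨h1, h2⟩
      · rw [← h2]; exact h.par_lt _ h1
      · exact absurd h2 (hno n h1)
    exact (RelEmbedding.natGT _ hlt).not_wellFounded wellFounded_lt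
  have hdown : ∀ i, R (n + i + 1) ≠ r ∧ par (R (n + i + 1)) = R (n + i) := by
    intro i
    induction i with
    | zero => exact hn
    | succ i ih =>
      rcases hstep (n + i + 1) with ⟨-, h2⟩ | h1
      · have := hR.1 (ih.2.symm.trans h2)
        omega
      · exact h1
  have hpos : ∀ i, pos (R (n + i)) = pos (R n) + i ∧ len (R (n + i)) = len (R n) := by
    intro i
    induction i with
    | zero => simp
    | succ i ih =>
      have h1 := h.pos_of_notMem _ (hdown i).1 ((hdown i).2 ▸ hB _)
      rw [(hdown i).2] at h1
      exact ⟨by rw [← add_assoc, h1.1, ih.1, add_assoc], by rw [← add_assoc, h1.2, ih.2]⟩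
  have h1 := hpos (len (R n) + 1)
  have h2 := h.pos_le (R (n + (len (R n) + 1)))
  omega

theorem pos_add_length (h : IsSegmentTree T r par d B pos len ell) {u y : V} (W : T.Walk u y)
    (hW : W.IsPath) (hpar : par u ∉ W.support) (hy : y ∈ B)
    (hB : ∀ v ∈ W.support, v ≠ y → v ∉ B) : pos u + W.length = len u := by
  induction W with
  | nil => simpa using h.pos_eq _ hy
  | @cons u w y ha W ih =>
    rw [Walk.cons_isPath_iff] at hW
    have huB : u ∉ B := hB u (by simp) (fun e => hW.2 (e ▸ W.end_mem_support))
    rcases (h.adj_iff _ _).1 ha with ⟨-, rfl⟩ | ⟨h1, rfl⟩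
    · simp at hpar
    · have := ih hW.1 hW.2 hy fun v hv => hB v (by simp [hv])
      have h2 := h.pos_of_notMem w h1 huB
      rw [Walk.length_cons]
      omega

theorem exists_rootPath_through [WellFoundedLT D] (h : IsSegmentTree T r par d B pos len ell)
    {u y c : V} (W : T.Walk u y) (hW : W.IsPath) (hc : c ≠ r) (hcu : par c = u)
    (hcW : c ∉ W.support) (hB : ∀ v ∈ W.support, v ≠ y → v ∉ B) :
    ∃ P : T.Walk u r, P.IsPath ∧ (∀ v ∈ P.support, d v ≤ d u) ∧ y ∈ P.support := by
  induction W generalizing c with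
  | @nil u =>
    obtain ⟨P, hP, hd⟩ := h.exists_rootPath u
    exact ⟨P, hP, hd, P.start_mem_support⟩
  | @cons u w y ha W ih =>
    rw [Walk.cons_isPath_iff] at hW
    have huB : u ∉ B := hB u (by simp) (fun e => hW.2 (e ▸ W.end_mem_support))
    have hur : u ≠ r := fun e => huB (e ▸ h.root_mem)
    rcases (h.adj_iff _ _).1 ha with ⟨-, rfl⟩ | ⟨h1, h2⟩
    · obtain ⟨P, hP, hd, hy⟩ := ih hW.1 hur rfl hW.2 fun v hv => hB v (by simp [hv])
      refine ⟨.cons ha P, ?_, ?_, by simp [hy]⟩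
      · rw [Walk.cons_isPath_iff]
        exact ⟨hP, fun hm => absurd (hd _ hm) (not_le.2 (h.par_lt u hur))⟩
      · intro v hv
        rw [Walk.support_cons, List.mem_cons] at hv
        rcases hv with rfl | hv
        · exact le_rfl
        · exact (hd v hv).trans (h.par_lt u hur).le
    · obtain ⟨c', -, -, hu⟩ := h.unique_child u huB
      rw [hu c hc hcu, ← hu w h1 h2] at hcW
      simp at hcW

theorem length_of_subdividedEdge [WellFoundedLT D] [Countable V]
    (h : IsSegmentTree T r par d B pos len ell) {x y : V} (W : T.Walk x y)
    (hW : SubdividedEdge T W) (hy : ∀ P : T.Walk x r, P.IsPath → y ∉ P.support) :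
    W.length = ell x := by
  obtain ⟨hp, hx, hyB, hl, hint⟩ := hW
  rw [h.branchVtx_iff] at hx hyB
  cases W with
  | nil => simp at hl
  | @cons _ w _ ha W =>
    rw [Walk.cons_isPath_iff] at hp
    have hB : ∀ v ∈ W.support, v ≠ y → v ∉ B := fun v hv hvy => by
      rw [← h.branchVtx_iff]
      exact hint v (by simp [hv]) (fun e => hp.2 (e ▸ hv)) hvy
    rcases (h.adj_iff _ _).1 ha with ⟨h1, rfl⟩ | ⟨h1, rfl⟩
    · obtain ⟨P, hP, hd, hyP⟩ := h.exists_rootPath_through W hp.1 h1 rfl hp.2 hB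
      refine absurd ?_ (hy (.cons ha P) ?_)
      · simp [hyP]
      · rw [Walk.cons_isPath_iff]
        exact ⟨hP, fun hm => absurd (hd _ hm) (not_le.2 (h.par_lt x h1))⟩
    · have h2 := h.pos_add_length W hp.1 hp.2 hyB hB
      have h3 := h.pos_of_mem w h1 hx
      rw [Walk.length_cons]
      omega

theorem uniformSubdivTOmega [WellFoundedLT D] [Countable V]
    (h : IsSegmentTree T r par d B pos len ell) : UniformSubdivTOmega T := by
  refine ⟨⟨h.isTree, fun v => ?_, fun R hR => ?_⟩, r, (h.branchVtx_iff r).2 h.root_mem, ?_⟩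
  · by_cases hv : v ∈ B
    · exact Or.inr ((h.branchVtx_iff v).2 hv)
    · exact Or.inl (h.neighborSet_of_notMem hv)
  · obtain ⟨n, hn⟩ := h.exists_mem_of_isRay hR
    exact ⟨n, (h.branchVtx_iff _).2 hn⟩
  · intro x y z W W' hW hW' hy hz
    rw [h.length_of_subdividedEdge W hW hy, h.length_of_subdividedEdge W' hW' hz]

end IsSegmentTree

end SimpleGraph

/-- The number of vertices in the `n`-th segment, when the `n + 1`-st segment branches off from the
end of segment `n.unpair.1` and `ell k` is the length of segments branching off from segment `k`. -/
def segLen (ell : ℕ → ℕ) : ℕ → ℕ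
  | 0 => 1
  | n + 1 => ell n.unpair.1

theorem segLen_pos {ell : ℕ → ℕ} (hell : ∀ n, 0 < ell n) : ∀ n, 0 < segLen ell n
  | 0 => Nat.one_pos
  | _ + 1 => hell _

/-- The pair `(n, j)` stands for the `j`-th vertex, counted from zero, in the `n`-th segment. -/
abbrev SegVertex (ell : ℕ → ℕ) : Type := {p : ℕ × ℕ // p.2 < segLen ell p.1}

namespace SegVertex

variable {ell : ℕ → ℕ}

/-- The only vertex of the zeroth segment. -/
def root (ell : ℕ → ℕ) : SegVertex ell := ⟨(0, 0), Nat.one_pos⟩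

/-- The last vertex of the `n`-th segment. -/
def last (hell : ∀ n, 0 < ell n) (n : ℕ) : SegVertex ell :=
  ⟨(n, segLen ell n - 1), Nat.sub_lt (segLen_pos hell n) Nat.one_pos⟩

/-- The previous vertex on the way to the root. -/
def par (hell : ∀ n, 0 < ell n) : SegVertex ell → SegVertex ell
  | ⟨(n, j + 1), h⟩ => ⟨(n, j), (Nat.lt_succ_self j).trans h⟩
  | ⟨(n + 1, 0), _⟩ => last hell n.unpair.1
  | ⟨(0, 0), h⟩ => ⟨(0, 0), h⟩

/-- The tree of segments. -/
def tree (hell : ∀ n, 0 < ell n) : SimpleGraph (SegVertex ell) :=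
  .fromRel fun u v => u ≠ root ell ∧ par hell u = v

theorem par_lt (hell : ∀ n, 0 < ell n) (v : SegVertex ell) (hv : v ≠ root ell) :
    toLex (par hell v).1 < toLex v.1 := by
  rcases v with ⟨⟨_ | n, _ | j⟩, h⟩
  · exact absurd rfl hv
  · simp [par, Prod.Lex.toLex_lt_toLex]
  · have := Nat.unpair_left_le n
    simp only [par, last, Prod.Lex.toLex_lt_toLex]
    omega
  · simp [par, Prod.Lex.toLex_lt_toLex]

theorem tree_isSegmentTree (hell : ∀ n, 0 < ell n) :
    (tree hell).IsSegmentTree (root ell) (par hell) (fun v => toLex v.1)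
      {v | v.1.2 + 1 = segLen ell v.1.1} (fun v => v.1.2 + 1) (fun v => segLen ell v.1.1)
      (fun v => ell v.1.1) where
  adj_iff u v := by
    rw [tree, SimpleGraph.fromRel_adj, and_iff_right_of_imp]
    rintro (⟨h, h'⟩ | ⟨h, h'⟩) rfl
    · exact (par_lt hell u h).ne (by rw [h'])
    · exact (par_lt hell u h).ne (by rw [h'])
  par_lt := par_lt hell
  root_mem := rfl
  infinite_children := by
    rintro ⟨⟨n, j⟩, h⟩ hv
    refine Set.infinite_of_injective_forall_mem
      (f := fun i => (⟨(Nat.pair n i + 1, 0), hell _⟩ : SegVertex ell)) ?_ ?_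
    · intro i i' hi
      simpa [Subtype.ext_iff] using hi
    · intro i
      refine ⟨by simp [root, Subtype.ext_iff], ?_⟩
      simp only [Set.mem_ofPred_eq] at hv
      simp only [par, last, Nat.unpair_pair, Subtype.mk.injEq, Prod.mk.injEq, true_and]
      omega
  unique_child := by
    rintro ⟨⟨n, j⟩, h⟩ hv
    simp only [Set.mem_ofPred_eq] at hv h
    refine ⟨⟨(n, j + 1), by simp only; omega⟩, by simp [root, Subtype.ext_iff], rfl, ?_⟩
    rintro ⟨⟨_ | n', _ | j'⟩, h'⟩ hr hc
    · exact absurd rfl hr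
    · simpa [par] using hc
    · have := segLen_pos hell n'.unpair.1
      simp only [par, last, Subtype.mk.injEq, Prod.mk.injEq] at hc
      obtain ⟨rfl, rfl⟩ := hc
      omega
    · simpa [par] using hc
  pos_of_mem := by
    rintro ⟨⟨_ | n, _ | j⟩, h⟩ hr hp
    · exact absurd rfl hr
    · simp only [par, Set.mem_ofPred_eq] at hp h
      omega
    · exact ⟨rfl, rfl⟩
    · simp only [par, Set.mem_ofPred_eq] at hp h
      omega
  pos_of_notMem := by
    rintro ⟨⟨_ | n, _ | j⟩, h⟩ hr hp
    · exact absurd rfl hr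
    · exact ⟨rfl, rfl⟩
    · exact absurd (Nat.sub_add_cancel (segLen_pos hell n.unpair.1)) hp
    · exact ⟨rfl, rfl⟩
  pos_le v := v.2
  pos_eq _ hv := hv

end SegVertex

theorem SimpleGraph.IsSegmentTree.comap_symm {V W D : Type} [LinearOrder D] {T : SimpleGraph V}
    {r : V} {par : V → V} {d : V → D} {B : Set V} {pos len ell : V → ℕ}
    (h : IsSegmentTree T r par d B pos len ell) (e : V ≃ W) :
    IsSegmentTree (T.comap e.symm) (e r) (e ∘ par ∘ e.symm) (d ∘ e.symm) (e.symm ⁻¹' B)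
      (pos ∘ e.symm) (len ∘ e.symm) (ell ∘ e.symm) where
  adj_iff := e.forall_congr_right.1 fun u => e.forall_congr_right.1 fun v => by
    simpa using h.adj_iff u v
  par_lt := e.forall_congr_right.1 fun v => by simpa using h.par_lt v
  root_mem := by simpa using h.root_mem
  infinite_children := e.forall_congr_right.1 fun v hv => by
    refine ((h.infinite_children v (by simpa using hv)).image e.injective.injOn).mono ?_
    rintro _ ⟨c, hc, rfl⟩
    simpa using hc
  unique_child := e.forall_congr_right.1 fun v hv => by
    obtain ⟨c, hc⟩ := h.unique_child v (by simpa using hv)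
    refine ⟨e c, by simpa using hc.1, by simpa using hc.2.1, e.forall_congr_right.1 fun c' => ?_⟩
    simpa using hc.2.2 c'
  pos_of_mem := e.forall_congr_right.1 fun v => by simpa using h.pos_of_mem v
  pos_of_notMem := e.forall_congr_right.1 fun v => by simpa using h.pos_of_notMem v
  pos_le _ := h.pos_le _
  pos_eq _ hv := h.pos_eq _ hv

/-- An embedded tree of segments is a uniform subdivision of `T_ω`. -/
theorem exists_uniformSubdivTOmega_of_embedding {X : Type} (G : SimpleGraph X) {ell : ℕ → ℕ}
    (hell : ∀ n, 0 < ell n) (φ : SegVertex ell → X) (hφ : Function.Injective φ)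
    (hadj : ∀ v, v ≠ SegVertex.root ell → G.Adj (φ v) (φ (SegVertex.par hell v))) :
    ∃ (s : Set X) (T : SimpleGraph s), T ≤ G.induce s ∧ UniformSubdivTOmega T := by
  let e := Equiv.ofInjective φ hφ
  have : Countable (Set.range φ) := e.symm.injective.countable
  have h := SegVertex.tree_isSegmentTree hell
  refine ⟨Set.range φ, _, ?_, (h.comap_symm e).uniformSubdivTOmega⟩
  suffices ∀ u v, (SegVertex.tree hell).Adj u v → G.Adj (φ u) (φ v) by
    intro u v huv
    obtain ⟨u, rfl⟩ := e.surjective u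
    obtain ⟨v, rfl⟩ := e.surjective v
    exact this u v (by simpa using huv)
  intro u v huv
  rcases (h.adj_iff u v).1 huv with ⟨h1, rfl⟩ | ⟨h1, rfl⟩
  · exact hadj u h1
  · exact (hadj v h1).symm

/-- An infinite family of disjoint paths of equal length has a member that avoids a given finite
set, except at the start. -/
theorem DisjPathFam.exists_avoiding {X : Type} {G : SimpleGraph X} {x : X}
    {Ps : Set (Σ y : X, G.Walk x y)} (h : DisjPathFam G x Ps) (hinf : Ps.Infinite)
    (F : Finset X) : ∃ P ∈ Ps, ∀ v ∈ P.2.support, v ∈ F → v = x := by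
  by_contra! hF
  have : Nonempty X := ⟨x⟩
  choose! g hg hgF hgx using hF
  refine hinf (Set.Finite.of_finite_image (F.finite_toSet.subset ?_) (f := g) ?_)
  · rintro _ ⟨P, hP, rfl⟩
    exact hgF P hP
  · intro P hP Q hQ hPQ
    by_contra hne
    exact hgx P hP (h.2 P hP Q hQ hne _ (hg P hP) (hPQ ▸ hg Q hQ))

theorem DisjPathFam.length_pos {X : Type} {G : SimpleGraph X} {x : X}
    {Ps : Set (Σ y : X, G.Walk x y)} {m : ℕ} (hinf : Ps.Infinite)
    (hm : ∀ P ∈ Ps, P.2.length = m) : 0 < m := by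
  by_contra! h0
  refine hinf ((Set.finite_singleton ⟨x, .nil⟩).subset ?_)
  rintro ⟨y, P⟩ hP
  have := hm _ hP
  cases P with
  | nil => rfl
  | cons _ _ =>
    simp at this
    omega

theorem exists_injOn_avoiding {X : Type} {G : SimpleGraph X} {x : X} {U : Set X}
    {Ps : Set (Σ y : X, G.Walk x y)} {m : ℕ} (h : DisjPathFam G x Ps) (hinf : Ps.Infinite)
    (hm : ∀ P ∈ Ps, P.2.length = m) (hU : ∀ P ∈ Ps, P.1 ∈ U) (F : Finset X) :
    ∃ f : ℕ → X, f 0 = x ∧ f m ∈ U ∧ (∀ i < m, G.Adj (f i) (f (i + 1))) ∧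
      Set.InjOn f {i | i ≤ m} ∧ ∀ i, 0 < i → i ≤ m → f i ∉ F := by
  obtain ⟨⟨y, P⟩, hP, hF⟩ := h.exists_avoiding hinf F
  obtain rfl := hm _ hP
  have hi := (h.1 _ hP).getVert_injOn
  refine ⟨P.getVert, P.getVert_zero, ?_, fun i hi => P.adj_getVert_succ hi, hi, ?_⟩
  · rw [P.getVert_length]
    exact hU _ hP
  · intro i h0 hil hiF
    have hx := hF _ (P.getVert_mem_support i) hiF
    have := hi (show i ≤ P.length from hil) (Nat.zero_le _) (hx.trans P.getVert_zero.symm)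
    omega

theorem exists_uniformSubdivTOmega {X : Type} (G : SimpleGraph X) {U : Set X} {x₀ : X}
    (hx₀ : x₀ ∈ U) (m : X → ℕ) (hm : ∀ x ∈ U, 0 < m x)
    (hU : ∀ x ∈ U, ∀ F : Finset X,
      ∃ f : ℕ → X, f 0 = x ∧ f (m x) ∈ U ∧ (∀ i < m x, G.Adj (f i) (f (i + 1))) ∧
        Set.InjOn f {i | i ≤ m x} ∧ ∀ i, 0 < i → i ≤ m x → f i ∉ F) :
    ∃ (s : Set X) (T : SimpleGraph s), T ≤ G.induce s ∧ UniformSubdivTOmega T := by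
  classical
  have : Nonempty X := ⟨x₀⟩
  choose! p hp0 hpU hpadj hpinj hpF using hU
  -- The branch vertices and the set of all vertices chosen so far.
  let st : ℕ → (ℕ → X) × Finset X := fun n => n.rec (fun _ => x₀, {x₀}) fun n s =>
    let x := s.1 n.unpair.1
    (Function.update s.1 (n + 1) (p x s.2 (m x)), s.2 ∪ (Finset.range (m x + 1)).image (p x s.2))
  let b : ℕ → X := fun n => (st n).1 n
  let q : ℕ → ℕ → X := fun n => p (b n.unpair.1) (st n).2
  have hstable : ∀ n i, i ≤ n → (st n).1 i = b i := by
    intro n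
    induction n with
    | zero => intro i hi; obtain rfl : i = 0 := by omega
              rfl
    | succ n ih =>
      intro i hi
      rcases hi.lt_or_eq with h | rfl
      · rw [← ih i (by omega)]
        exact Function.update_of_ne h.ne _ _
      · rfl
  have ha : ∀ n, (st n).1 n.unpair.1 = b n.unpair.1 := fun n => hstable n _ (Nat.unpair_left_le n)
  have hbsucc : ∀ n, b (n + 1) = q n (m (b n.unpair.1)) := by
    intro n
    change Function.update _ _ _ _ = _
    rw [Function.update_self]
    change p ((st n).1 n.unpair.1) _ (m ((st n).1 n.unpair.1)) = _
    rw [ha]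
  have hF : ∀ n, (st (n + 1)).2 =
      (st n).2 ∪ (Finset.range (m (b n.unpair.1) + 1)).image (q n) := by
    intro n
    change (st n).2 ∪ (Finset.range (m ((st n).1 n.unpair.1) + 1)).image
      (p ((st n).1 n.unpair.1) _) = _
    rw [ha]
  have hbU : ∀ n, b n ∈ U := by
    intro n
    induction n using Nat.strong_induction_on with
    | _ n ih =>
      cases n with
      | zero => exact hx₀
      | succ n =>
        rw [hbsucc]
        exact hpU _ (ih _ (Nat.lt_succ_of_le (Nat.unpair_left_le n))) _
  have hmono : Monotone fun n => (st n).2 := monotone_nat_of_le_succ fun n => by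
    rw [hF]
    exact Finset.subset_union_left
  have hell : ∀ n, 0 < m (b n) := fun n => hm _ (hbU n)
  let φ : ℕ → ℕ → X := fun n j => n.casesOn (b 0) fun n => q n (j + 1)
  have hmem : ∀ n j, j < segLen (m ∘ b) n → φ n j ∈ (st n).2 := by
    intro n j hj
    cases n with
    | zero => exact Finset.mem_singleton_self _
    | succ n =>
      rw [hF]
      refine Finset.mem_union_right _ (Finset.mem_image_of_mem _ (Finset.mem_range.2 ?_))
      simpa [segLen] using hj
  have hnotMem : ∀ n j, j < segLen (m ∘ b) (n + 1) → φ (n + 1) j ∉ (st n).2 := fun n j hj =>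
    hpF _ (hbU _) _ _ j.succ_pos hj
  have hne : ∀ n n' j j', n < n' → j < segLen (m ∘ b) n → j' < segLen (m ∘ b) n' →
      φ n j ≠ φ n' j' := by
    intro n n' j j' hn hj hj' he
    obtain ⟨n', rfl⟩ : ∃ k, n' = k + 1 := ⟨n' - 1, by omega⟩
    exact hnotMem n' j' hj' (he ▸ hmono (Nat.le_of_lt_succ hn) (hmem n j hj))
  have hlast : ∀ n, φ n (segLen (m ∘ b) n - 1) = b n := by
    intro n
    cases n with
    | zero => rfl
    | succ n =>
      rw [hbsucc]
      change q n (m (b n.unpair.1) - 1 + 1) = _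
      rw [Nat.sub_add_cancel (hell _)]
  refine exists_uniformSubdivTOmega_of_embedding G (ell := m ∘ b) hell (fun v => φ v.1.1 v.1.2)
    ?_ ?_
  · rintro ⟨⟨n, j⟩, h⟩ ⟨⟨n', j'⟩, h'⟩ he
    rcases lt_trichotomy n n' with hn | rfl | hn
    · exact absurd he (hne _ _ _ _ hn h h')
    · cases n with
      | zero =>
        have h1 : j < 1 := h
        have h2 : j' < 1 := h'
        exact Subtype.ext (Prod.ext rfl (show j = j' by omega))
      | succ n =>
        have := hpinj _ (hbU _) _ (show j + 1 ≤ _ from h) (show j' + 1 ≤ _ from h') he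
        simpa using this
    · exact absurd he.symm (hne _ _ _ _ hn h' h)
  · rintro ⟨⟨_ | n, _ | j⟩, h⟩ hr
    · exact absurd rfl hr
    · simp [segLen] at h
    · change G.Adj (φ (n + 1) 0) (φ n.unpair.1 (segLen (m ∘ b) n.unpair.1 - 1))
      rw [hlast, ← hp0 _ (hbU n.unpair.1) (st n).2]
      exact (hpadj _ (hbU _) _ 0 (hell _)).symm
    · exact (hpadj _ (hbU _) _ (j + 1) h).symm

theorem exists_infinite_disjPathFam {X : Type} (G : SimpleGraph X) (S : Ordinal → Set X)
    (hS : ∀ ξ : Ordinal, 0 < ξ → S ξ = {x : X | ∀ m : ℕ,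
      ∀ Ps : Set (Σ y : X, G.Walk x y), DisjPathFam G x Ps →
        (∀ P ∈ Ps, (Sigma.snd P).length = m) →
        (∀ P ∈ Ps, Sigma.fst P ∉ ⋃ ζ ∈ Set.Iio ξ, S ζ) → Ps.Finite})
    {x : X} (hx : ∀ ξ, x ∉ S ξ) :
    ∃ (m : ℕ) (Ps : Set (Σ y : X, G.Walk x y)), DisjPathFam G x Ps ∧ Ps.Infinite ∧
      (∀ P ∈ Ps, P.2.length = m) ∧ ∀ P ∈ Ps, P.1 ∈ {y | ∀ ξ, y ∉ S ξ} := by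
  have hrank : ∀ y, ∃ o, ∀ ξ, y ∈ S ξ → y ∈ S o := fun y => by
    by_cases h : ∃ o, y ∈ S o
    · exact h.imp fun _ ho _ _ => ho
    · exact ⟨0, fun ξ hξ => absurd ⟨ξ, hξ⟩ h⟩
  choose o ho using hrank
  obtain ⟨η, hη⟩ := Ordinal.bddAbove_of_small (s := Set.range o)
  have hxη := hx (Order.succ η)
  rw [hS _ (Order.bot_lt_succ η)] at hxη
  simp only [Set.mem_ofPred_eq, not_forall] at hxη
  obtain ⟨m, Ps, hd, hlen, hend, hinf⟩ := hxη
  refine ⟨m, Ps, hd, hinf, hlen, fun P hP ξ hξ => hend P hP ?_⟩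
  exact Set.mem_biUnion (Order.lt_succ_of_le (hη ⟨_, rfl⟩)) (ho _ ξ hξ)

/-- If the rank `ρ` (least `ξ` with `x ∈ Σ_ξ`, for the length-restricted `Σ`'s) is
undefined at some vertex, then `G` contains a uniform subdivision of `T_ω`. -/
theorem stmt11 {X : Type} (G : SimpleGraph X) (S : Ordinal → Set X)
    (h0 : S 0 = {x : X | (G.neighborSet x).Finite})
    (hS : ∀ ξ : Ordinal, 0 < ξ → S ξ = {x : X | ∀ m : ℕ,
      ∀ Ps : Set (Σ y : X, G.Walk x y), DisjPathFam G x Ps →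
        (∀ P ∈ Ps, (Sigma.snd P).length = m) →
        (∀ P ∈ Ps, Sigma.fst P ∉ ⋃ ζ ∈ Set.Iio ξ, S ζ) → Ps.Finite})
    (hx : ∃ x : X, ∀ ξ : Ordinal, x ∉ S ξ) :
    ∃ (s : Set X) (T : SimpleGraph s), T ≤ G.induce s ∧ UniformSubdivTOmega T := by
  obtain ⟨x₀, hx₀⟩ := hx
  have hU : ∀ x ∈ {y | ∀ ξ, y ∉ S ξ}, _ := fun x hx => exists_infinite_disjPathFam G S hS hx
  choose! m Ps hd hinf hlen hend using hU
  exact exists_uniformSubdivTOmega G (U := {y | ∀ ξ, y ∉ S ξ}) hx₀ m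
    (fun x hx => DisjPathFam.length_pos (hinf x hx) (hlen x hx))
    (fun x hx => exists_injOn_avoiding (hd x hx) (hinf x hx) (hlen x hx) (hend x hx))
end
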